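/- For every σ ∈ ℝ the identity q^{-1} B_{n−1}^2 B̂_n^σ − (q + q^{-1}) B_{n−1} B̂_n^σ B_{n−1} + q B̂_n^σ B_{n−1}^2 = q^{−σ−1} (q^{-2} − q^2) x_{n+1} y_{n−1} K_{n−1}^{-1} K_n^{-1} K_{n+1}^{-4} holds in U_q(g) = U_q(gl(2n)). -/

import Mathlib

namespace QG

/-- Generators of the quantized universal enveloping algebra `U_q(gl(m))`:
`K i`, its inverse `Ki i`, and the Chevalley generators `E j` (the `x_j`)
and `F j` (the `y_j`).  Indices are 1-based natural numbers; out-of-range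
generators are forced to be `1` (resp. `0`) by the relations. -/
inductive Gen : Type where
  | K : ℕ → Gen
  | Ki : ℕ → Gen
  | E : ℕ → Gen
  | F : ℕ → Gen

abbrev FA := FreeAlgebra ℂ Gen

noncomputable def fK (i : ℕ) : FA := FreeAlgebra.ι ℂ (Gen.K i)
noncomputable def fKi (i : ℕ) : FA := FreeAlgebra.ι ℂ (Gen.Ki i)
noncomputable def fE (i : ℕ) : FA := FreeAlgebra.ι ℂ (Gen.E i)
noncomputable def fF (i : ℕ) : FA := FreeAlgebra.ι ℂ (Gen.F i)

/-- Kronecker delta with values in `ℤ`. -/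
def kd (i j : ℕ) : ℤ := if i = j then 1 else 0

/-- The defining relations of `U_q(gl(m))`. -/
inductive Rel (q : ℝ) (m : ℕ) : FA → FA → Prop
  | Kout : ∀ i, ¬(1 ≤ i ∧ i ≤ m) → Rel q m (fK i) 1
  | Kiout : ∀ i, ¬(1 ≤ i ∧ i ≤ m) → Rel q m (fKi i) 1
  | Eout : ∀ j, ¬(1 ≤ j ∧ j + 1 ≤ m) → Rel q m (fE j) 0
  | Fout : ∀ j, ¬(1 ≤ j ∧ j + 1 ≤ m) → Rel q m (fF j) 0
  | KK : ∀ i j, Rel q m (fK i * fK j) (fK j * fK i)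
  | KKi : ∀ i, Rel q m (fK i * fKi i) 1
  | KiK : ∀ i, Rel q m (fKi i * fK i) 1
  | KE : ∀ i j, 1 ≤ i → i ≤ m → 1 ≤ j → j + 1 ≤ m →
      Rel q m (fK i * fE j) (((q : ℂ) ^ (kd i j - kd i (j+1))) • (fE j * fK i))
  | KF : ∀ i j, 1 ≤ i → i ≤ m → 1 ≤ j → j + 1 ≤ m →
      Rel q m (fK i * fF j) (((q : ℂ) ^ (kd i (j+1) - kd i j)) • (fF j * fK i))
  | EF : ∀ i j, 1 ≤ i → i + 1 ≤ m → 1 ≤ j → j + 1 ≤ m →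
      Rel q m (fE i * fF j - fF j * fE i)
        (if i = j then ((q : ℂ) - (q : ℂ)⁻¹)⁻¹ • (fK i * fKi (i+1) - fKi i * fK (i+1)) else 0)
  | EE : ∀ i j, 1 ≤ i → i + 1 ≤ m → 1 ≤ j → j + 1 ≤ m → (i + 2 ≤ j ∨ j + 2 ≤ i) →
      Rel q m (fE i * fE j) (fE j * fE i)
  | FF : ∀ i j, 1 ≤ i → i + 1 ≤ m → 1 ≤ j → j + 1 ≤ m → (i + 2 ≤ j ∨ j + 2 ≤ i) →
      Rel q m (fF i * fF j) (fF j * fF i)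
  | Eserre : ∀ i j, 1 ≤ i → i + 1 ≤ m → 1 ≤ j → j + 1 ≤ m → (i + 1 = j ∨ j + 1 = i) →
      Rel q m (fE i ^ 2 * fE j - ((q : ℂ) + (q : ℂ)⁻¹) • (fE i * fE j * fE i) + fE j * fE i ^ 2) 0
  | Fserre : ∀ i j, 1 ≤ i → i + 1 ≤ m → 1 ≤ j → j + 1 ≤ m → (i + 1 = j ∨ j + 1 = i) →
      Rel q m (fF i ^ 2 * fF j - ((q : ℂ) + (q : ℂ)⁻¹) • (fF i * fF j * fF i) + fF j * fF i ^ 2) 0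

/-- The quantized universal enveloping algebra `U_q(gl(m))`. -/
abbrev Uq (q : ℝ) (m : ℕ) := RingQuot (Rel q m)

noncomputable def uK (q : ℝ) (m i : ℕ) : Uq q m := RingQuot.mkAlgHom ℂ (Rel q m) (fK i)
noncomputable def uKi (q : ℝ) (m i : ℕ) : Uq q m := RingQuot.mkAlgHom ℂ (Rel q m) (fKi i)
noncomputable def uE (q : ℝ) (m i : ℕ) : Uq q m := RingQuot.mkAlgHom ℂ (Rel q m) (fE i)
noncomputable def uF (q : ℝ) (m i : ℕ) : Uq q m := RingQuot.mkAlgHom ℂ (Rel q m) (fF i)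

/-- `C_i = K_i K_{2n+1-i}` in `U_q(gl(2n))`. -/
noncomputable def Cc (q : ℝ) (n i : ℕ) : Uq q (2*n) := uK q (2*n) i * uK q (2*n) (2*n+1-i)
/-- `C_i⁻¹ = K_i⁻¹ K_{2n+1-i}⁻¹` in `U_q(gl(2n))`. -/
noncomputable def Ccinv (q : ℝ) (n i : ℕ) : Uq q (2*n) := uKi q (2*n) i * uKi q (2*n) (2*n+1-i)
/-- `B_j = y_j K_{j+1}⁻¹ K_{2n-j}⁻¹ + K_j⁻¹ x_{2n-j} K_{2n-j}⁻¹` in `U_q(gl(2n))`. -/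
noncomputable def Bb (q : ℝ) (n j : ℕ) : Uq q (2*n) :=
  uF q (2*n) j * uKi q (2*n) (j+1) * uKi q (2*n) (2*n-j)
  + uKi q (2*n) j * uE q (2*n) (2*n-j) * uKi q (2*n) (2*n-j)
/-- `B_n^σ = y_n K_{n+1}⁻¹ K_n⁻¹ + K_n⁻¹ x_n K_n⁻¹ + ((q^{-σ}-q^{σ})/(q-q⁻¹)) K_n⁻²`. -/
noncomputable def Bs (q σ : ℝ) (n : ℕ) : Uq q (2*n) :=
  uF q (2*n) n * uKi q (2*n) (n+1) * uKi q (2*n) n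
  + uKi q (2*n) n * uE q (2*n) n * uKi q (2*n) n
  + (((q ^ (-σ) - q ^ σ) / (q - q⁻¹) : ℝ) : ℂ) • ((uKi q (2*n) n)^2)

/-- The generating set of the coideal subalgebra `𝒜_σ ⊆ U_q(gl(2n))`. -/
def ASet (q σ : ℝ) (n : ℕ) : Set (Uq q (2*n)) :=
  {z | (∃ i, 1 ≤ i ∧ i ≤ 2*n ∧ (z = Cc q n i ∨ z = Ccinv q n i)) ∨
       (∃ j, 1 ≤ j ∧ j + 1 ≤ 2*n ∧ j ≠ n ∧ z = Bb q n j) ∨ z = Bs q σ n}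

/-- Generators of the abstract algebra `𝒜`. -/
inductive AGen : Type where
  | g : ℕ → AGen
  | gi : ℕ → AGen
  | b : ℕ → AGen

abbrev AFA := FreeAlgebra ℂ AGen

noncomputable def fγ (i : ℕ) : AFA := FreeAlgebra.ι ℂ (AGen.g i)
noncomputable def fγi (i : ℕ) : AFA := FreeAlgebra.ι ℂ (AGen.gi i)
noncomputable def fβ (j : ℕ) : AFA := FreeAlgebra.ι ℂ (AGen.b j)

/-- `(ε_i + ε_{2n+1-i}, α_j)` where `α_j = ε_j - ε_{j+1}`. -/
def gex (n i j : ℕ) : ℤ := kd i j + kd (2*n+1-i) j - kd i (j+1) - kd (2*n+1-i) (j+1)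

/-- The defining relations of the algebra `𝒜`. -/
inductive ARel (q : ℝ) (n : ℕ) : AFA → AFA → Prop
  | gout : ∀ i, ¬(1 ≤ i ∧ i ≤ 2*n) → ARel q n (fγ i) 1
  | giout : ∀ i, ¬(1 ≤ i ∧ i ≤ 2*n) → ARel q n (fγi i) 1
  | bout : ∀ j, ¬(1 ≤ j ∧ j + 1 ≤ 2*n) → ARel q n (fβ j) 0
  | gg : ∀ i j, ARel q n (fγ i * fγ j) (fγ j * fγ i)
  | ggi : ∀ i, ARel q n (fγ i * fγi i) 1
  | gig : ∀ i, ARel q n (fγi i * fγ i) 1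
  | gsym : ∀ i, 1 ≤ i → i ≤ 2*n → ARel q n (fγ i) (fγ (2*n+1-i))
  | gb : ∀ i j, 1 ≤ i → i ≤ 2*n → 1 ≤ j → j + 1 ≤ 2*n →
      ARel q n (fγ i * fβ j) (((q : ℂ) ^ (-(gex n i j))) • (fβ j * fγ i))
  | bb : ∀ i j, 1 ≤ i → i + 1 ≤ 2*n → 1 ≤ j → j + 1 ≤ 2*n → (i + 2 ≤ j ∨ j + 2 ≤ i) →
      ARel q n (fβ i * fβ j - fβ j * fβ i)
        (if i + j = 2*n then ((q : ℂ) * ((q : ℂ) - (q : ℂ)⁻¹)⁻¹) • (fγi i ^ 2 - fγi (i+1) ^ 2)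
         else 0)
  | serre1 : ∀ i, 1 ≤ i → i + 2 ≤ 2*n →
      ARel q n
        ((q : ℂ)⁻¹ • (fβ i ^ 2 * fβ (i+1)) - ((q : ℂ) + (q : ℂ)⁻¹) • (fβ i * fβ (i+1) * fβ i)
          + (q : ℂ) • (fβ (i+1) * fβ i ^ 2))
        (if i = n then (q : ℂ) • (fβ (n+1) * fγi n ^ 2) else 0)
  | serre2 : ∀ i, 2 ≤ i → i + 1 ≤ 2*n →
      ARel q n
        ((q : ℂ) • (fβ i ^ 2 * fβ (i-1)) - ((q : ℂ) + (q : ℂ)⁻¹) • (fβ i * fβ (i-1) * fβ i)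
          + (q : ℂ)⁻¹ • (fβ (i-1) * fβ i ^ 2))
        (if i = n then (q : ℂ)⁻¹ • (fβ (n-1) * fγi n ^ 2) else 0)

/-- The abstract algebra `𝒜`. -/
abbrev Aalg (q : ℝ) (n : ℕ) := RingQuot (ARel q n)

noncomputable def aγ (q : ℝ) (n i : ℕ) : Aalg q n := RingQuot.mkAlgHom ℂ (ARel q n) (fγ i)
noncomputable def aγi (q : ℝ) (n i : ℕ) : Aalg q n := RingQuot.mkAlgHom ℂ (ARel q n) (fγi i)
noncomputable def aβ (q : ℝ) (n j : ℕ) : Aalg q n := RingQuot.mkAlgHom ℂ (ARel q n) (fβ j)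

end QG

namespace QG

/-- `B_{n-1} = y_{n-1} K_n⁻¹ K_{n+1}⁻¹ + K_{n-1}⁻¹ x_{n+1} K_{n+1}⁻¹` in `U_q(gl(2n))`. -/
noncomputable def Bnm1 (q : ℝ) (n : ℕ) : Uq q (2*n) :=
  uF q (2*n) (n-1) * uKi q (2*n) n * uKi q (2*n) (n+1)
  + uKi q (2*n) (n-1) * uE q (2*n) (n+1) * uKi q (2*n) (n+1)

/-- `B̂_n^σ = (q^{-σ} K_{n+1}⁻² - q^{σ} K_n⁻²)/(q - q⁻¹)` in `U_q(gl(2n))`. -/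
noncomputable def Bhat (q σ : ℝ) (n : ℕ) : Uq q (2*n) :=
  ((q : ℂ) - (q : ℂ)⁻¹)⁻¹ •
    (((q ^ (-σ) : ℝ) : ℂ) • ((uKi q (2*n) (n+1))^2) - ((q ^ σ : ℝ) : ℂ) • ((uKi q (2*n) n)^2))

end QG

namespace QG

/-- The inverses of commuting elements commute. -/
lemma inv_commute {A : Type*} [Ring A] {K L K' L' : A} (h1 : K * L = 1) (h2 : L * K = 1)
    (h1' : K' * L' = 1) (h2' : L' * K' = 1) (h : Commute K K') : Commute L L' :=
  let u : Aˣ := ⟨K, L, h1, h2⟩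
  let v : Aˣ := ⟨K', L', h1', h2'⟩
  Commute.units_inv_left (u := u) (Commute.units_inv_right (u := v) h)

section General

variable {A : Type*} [Ring A] [Algebra ℂ A]

/-- If `K` `r`-commutes with `x`, then its inverse `r⁻¹`-commutes with `x`. -/
lemma inv_mul_eq_smul {K L x : A} {r : ℂ} (hr : r ≠ 0) (h1 : K * L = 1) (h2 : L * K = 1)
    (h : K * x = r • (x * K)) : L * x = r⁻¹ • (x * L) := by
  have h3 : L * (K * x) * L = r • (L * (x * K) * L) := by
    rw [h, mul_smul_comm, smul_mul_assoc]
  have h4 : L * (K * x) * L = x * L := by rw [← mul_assoc, h2, one_mul]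
  have h5 : L * (x * K) * L = L * x := by rw [mul_assoc, mul_assoc, h1, mul_one]
  rw [h4, h5] at h3
  rw [h3, smul_smul, inv_mul_cancel₀ hr, one_smul]

/-- The deformed Serre expression of `F b c + a E c` against a combination of `c²` and `b²`. -/
lemma serre_expression_eq {Q : ℂ} (hQ : Q ≠ 0) (hQ' : Q - Q⁻¹ ≠ 0) (s t : ℂ) {E F a b c : A}
    (hEF : E * F = F * E) (hba : b * a = a * b) (hca : c * a = a * c) (hcb : c * b = b * c)
    (haE : a * E = E * a) (hbE : b * E = E * b) (hcE : c * E = Q⁻¹ • (E * c))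
    (haF : a * F = Q • (F * a)) (hbF : b * F = Q⁻¹ • (F * b)) (hcF : c * F = F * c) :
    Q⁻¹ • ((F * b * c + a * E * c) ^ 2 * ((Q - Q⁻¹)⁻¹ • (s • c ^ 2 - t • b ^ 2)))
      - (Q + Q⁻¹) • ((F * b * c + a * E * c) * ((Q - Q⁻¹)⁻¹ • (s • c ^ 2 - t • b ^ 2))
          * (F * b * c + a * E * c))
      + Q • (((Q - Q⁻¹)⁻¹ • (s • c ^ 2 - t • b ^ 2)) * (F * b * c + a * E * c) ^ 2)
    = (s * Q⁻¹ * (Q ^ (-2 : ℤ) - Q ^ (2 : ℕ))) • (E * F * a * b * c ^ 4) := by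
  have hEF' (z : A) : E * (F * z) = F * (E * z) := by rw [← mul_assoc, hEF, mul_assoc]
  have hba' (z : A) : b * (a * z) = a * (b * z) := by rw [← mul_assoc, hba, mul_assoc]
  have hca' (z : A) : c * (a * z) = a * (c * z) := by rw [← mul_assoc, hca, mul_assoc]
  have hcb' (z : A) : c * (b * z) = b * (c * z) := by rw [← mul_assoc, hcb, mul_assoc]
  have haE' (z : A) : a * (E * z) = E * (a * z) := by rw [← mul_assoc, haE, mul_assoc]
  have hbE' (z : A) : b * (E * z) = E * (b * z) := by rw [← mul_assoc, hbE, mul_assoc]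
  have hcE' (z : A) : c * (E * z) = Q⁻¹ • (E * (c * z)) := by
    rw [← mul_assoc, hcE, smul_mul_assoc, mul_assoc]
  have haF' (z : A) : a * (F * z) = Q • (F * (a * z)) := by
    rw [← mul_assoc, haF, smul_mul_assoc, mul_assoc]
  have hbF' (z : A) : b * (F * z) = Q⁻¹ • (F * (b * z)) := by
    rw [← mul_assoc, hbF, smul_mul_assoc, mul_assoc]
  have hcF' (z : A) : c * (F * z) = F * (c * z) := by rw [← mul_assoc, hcF, mul_assoc]
  have hD : Q ^ 2 - 1 ≠ 0 := by
    intro h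
    apply hQ'
    field_simp
    rw [h, mul_zero]
  simp only [pow_succ, pow_zero, one_mul, mul_assoc, mul_add, add_mul, mul_sub, sub_mul,
    smul_mul_assoc, mul_smul_comm, hEF, hcb, haE,
    hEF', hba', hca', hcb', haE', hbE', hcE', haF', hbF', hcF']
  match_scalars <;> field_simp <;> ring

end General

section Relations

variable {q : ℝ} {m : ℕ}

lemma uK_mul_uKi (i : ℕ) : uK q m i * uKi q m i = 1 := by
  simpa [uK, uKi] using RingQuot.mkAlgHom_rel ℂ (Rel.KKi (q := q) (m := m) i)

lemma uKi_mul_uK (i : ℕ) : uKi q m i * uK q m i = 1 := by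
  simpa [uK, uKi] using RingQuot.mkAlgHom_rel ℂ (Rel.KiK (q := q) (m := m) i)

lemma uKi_commute (i j : ℕ) : uKi q m i * uKi q m j = uKi q m j * uKi q m i := by
  have h : uK q m i * uK q m j = uK q m j * uK q m i := by
    simpa [uK] using RingQuot.mkAlgHom_rel ℂ (Rel.KK (q := q) (m := m) i j)
  exact inv_commute (uK_mul_uKi i) (uKi_mul_uK i) (uK_mul_uKi j) (uKi_mul_uK j) h

lemma uKi_mul_uE (hq : (q : ℂ) ≠ 0) {i j : ℕ} (hi : 1 ≤ i) (him : i ≤ m) (hj : 1 ≤ j)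
    (hjm : j + 1 ≤ m) :
    uKi q m i * uE q m j = ((q : ℂ) ^ (kd i j - kd i (j + 1)))⁻¹ • (uE q m j * uKi q m i) := by
  refine inv_mul_eq_smul (zpow_ne_zero _ hq) (uK_mul_uKi i) (uKi_mul_uK i) ?_
  simpa only [uK, uE, map_mul, map_smul] using
    RingQuot.mkAlgHom_rel ℂ (Rel.KE (q := q) (m := m) i j hi him hj hjm)

lemma uKi_mul_uF (hq : (q : ℂ) ≠ 0) {i j : ℕ} (hi : 1 ≤ i) (him : i ≤ m) (hj : 1 ≤ j)
    (hjm : j + 1 ≤ m) :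
    uKi q m i * uF q m j = ((q : ℂ) ^ (kd i (j + 1) - kd i j))⁻¹ • (uF q m j * uKi q m i) := by
  refine inv_mul_eq_smul (zpow_ne_zero _ hq) (uK_mul_uKi i) (uKi_mul_uK i) ?_
  simpa only [uK, uF, map_mul, map_smul] using
    RingQuot.mkAlgHom_rel ℂ (Rel.KF (q := q) (m := m) i j hi him hj hjm)

lemma uE_mul_uF_of_ne {i j : ℕ} (hi : 1 ≤ i) (him : i + 1 ≤ m) (hj : 1 ≤ j) (hjm : j + 1 ≤ m)
    (hij : i ≠ j) : uE q m i * uF q m j = uF q m j * uE q m i := by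
  have h := RingQuot.mkAlgHom_rel ℂ (Rel.EF (q := q) (m := m) i j hi him hj hjm)
  rw [if_neg hij, map_zero, map_sub, map_mul, map_mul] at h
  exact sub_eq_zero.mp h

end Relations

end QG

open QG in
/-- For every `σ ∈ ℝ`, the identity
`q⁻¹ B_{n-1}² B̂_n^σ − (q+q⁻¹) B_{n-1} B̂_n^σ B_{n-1} + q B̂_n^σ B_{n-1}²
  = q^{−σ−1}(q⁻² − q²) x_{n+1} y_{n−1} K_{n−1}⁻¹ K_n⁻¹ K_{n+1}⁻⁴`
holds in `U_q(gl(2n))`. -/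
theorem statement_19 (q : ℝ) (hq0 : 0 < q) (hq1 : q < 1) (n : ℕ) (hn : 2 ≤ n) (σ : ℝ) :
    (q : ℂ)⁻¹ • (Bnm1 q n ^ 2 * Bhat q σ n)
      - ((q : ℂ) + (q : ℂ)⁻¹) • (Bnm1 q n * Bhat q σ n * Bnm1 q n)
      + (q : ℂ) • (Bhat q σ n * Bnm1 q n ^ 2)
    = (((q ^ (-σ - 1) : ℝ) : ℂ) * ((q : ℂ) ^ (-2 : ℤ) - (q : ℂ) ^ (2 : ℕ))) •
        (uE q (2*n) (n+1) * uF q (2*n) (n-1) * uKi q (2*n) (n-1) * uKi q (2*n) n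
          * (uKi q (2*n) (n+1))^4) := by
  obtain ⟨k, rfl⟩ : ∃ k, n = k + 2 := ⟨n - 2, by omega⟩
  have hQ : (q : ℂ) ≠ 0 := by exact_mod_cast hq0.ne'
  have hQ' : (q : ℂ) - (q : ℂ)⁻¹ ≠ 0 := by
    have : q - q⁻¹ ≠ 0 := by
      have := (one_lt_inv₀ hq0).mpr hq1
      linarith
    exact_mod_cast this
  have hs : ((q ^ (-σ - 1) : ℝ) : ℂ) = ((q ^ (-σ) : ℝ) : ℂ) * (q : ℂ)⁻¹ := by
    rw [Real.rpow_sub_one hq0.ne', div_eq_mul_inv]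
    push_cast
    rfl
  have hE (i : ℕ) (hi : 1 ≤ i) (him : i ≤ 2 * (k + 2)) :=
    uKi_mul_uE hQ (j := k + 3) hi him (by omega) (by omega)
  have hF (i : ℕ) (hi : 1 ≤ i) (him : i ≤ 2 * (k + 2)) :=
    uKi_mul_uF hQ (j := k + 1) hi him (by omega) (by omega)
  rw [hs]
  refine serre_expression_eq hQ hQ' _ _
    (uE_mul_uF_of_ne (by omega) (by omega) (by omega) (by omega) (by omega))
    (uKi_commute _ _) (uKi_commute _ _) (uKi_commute _ _) ?_ ?_ ?_ ?_ ?_ ?_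
  · simpa [kd] using hE (k + 1) (by omega) (by omega)
  · simpa [kd] using hE (k + 2) (by omega) (by omega)
  · simpa [kd] using hE (k + 3) (by omega) (by omega)
  · simpa [kd] using hF (k + 1) (by omega) (by omega)
  · simpa [kd] using hF (k + 2) (by omega) (by omega)
  · simpa [kd] using hF (k + 3) (by omega) (by omega)
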